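/- For all real m ≥ 0 and y > 0, the integral ∫₀^∞ p·J₀(py)·ln( p/(m + √(m² + p²)) ) dp converges (as an improper/Abel-summable oscillatory integral) and equals (e^{−my} − 1)/y². -/

import Mathlib

open MeasureTheory Real Filter intervalIntegral

/-- The Bessel function of the first kind of order 0,
`J₀(x) = (1/π) ∫₀^π cos(x sin θ) dθ`. -/
noncomputable def besselJ0 (x : ℝ) : ℝ :=
  (1 / Real.pi) * ∫ θ in (0:ℝ)..Real.pi, Real.cos (x * Real.sin θ)

section

open Set Topology

lemma hasDerivAt_sqrt_add_sq {c : ℝ} (hc : 0 < c) (x : ℝ) :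
    HasDerivAt (fun x : ℝ => √(c + x ^ 2)) (x / √(c + x ^ 2)) x := by
  have h : 0 < c + x ^ 2 := by positivity
  have := (((hasDerivAt_id x).pow 2).const_add c).sqrt h.ne'
  simp only [Pi.pow_apply, id] at this
  refine this.congr_deriv ?_
  push_cast
  field_simp

lemma hasDerivAt_inv_sqrt_add_sq {c : ℝ} (hc : 0 < c) (x : ℝ) :
    HasDerivAt (fun x : ℝ => (√(c + x ^ 2))⁻¹) (-(x * (√(c + x ^ 2) ^ 3)⁻¹)) x := by
  have h : 0 < √(c + x ^ 2) := by positivity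
  refine ((hasDerivAt_sqrt_add_sq hc x).fun_inv h.ne').congr_deriv ?_
  field_simp

lemma hasDerivAt_div_sqrt_add_sq {c : ℝ} (hc : 0 < c) (x : ℝ) :
    HasDerivAt (fun x : ℝ => c⁻¹ * (x * (√(c + x ^ 2))⁻¹)) (√(c + x ^ 2) ^ 3)⁻¹ x := by
  have h : 0 < √(c + x ^ 2) := by positivity
  have h2 : √(c + x ^ 2) ^ 2 = c + x ^ 2 := sq_sqrt (by positivity)
  refine (((hasDerivAt_id x).mul (hasDerivAt_inv_sqrt_add_sq hc x)).const_mul c⁻¹).congr_deriv ?_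
  simp only [id]
  field_simp
  linarith

lemma tendsto_sqrt_add_sq_atTop (c : ℝ) :
    Tendsto (fun x : ℝ => √(c + x ^ 2)) atTop atTop :=
  tendsto_sqrt_atTop.comp (tendsto_atTop_add_const_left _ c (tendsto_pow_atTop two_ne_zero))

lemma tendsto_div_sqrt_add_sq_atTop (c : ℝ) :
    Tendsto (fun x : ℝ => x * (√(c + x ^ 2))⁻¹) atTop (𝓝 1) := by
  have h : Tendsto (fun x : ℝ => (√(c * (x ^ 2)⁻¹ + 1))⁻¹) atTop (𝓝 1) := by
    have h0 : Tendsto (fun x : ℝ => (x ^ 2)⁻¹) atTop (𝓝 0) :=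
      tendsto_inv_atTop_zero.comp (tendsto_pow_atTop two_ne_zero)
    simpa using (((h0.const_mul c).add_const 1).sqrt).inv₀ (by simp)
  refine h.congr' ?_
  filter_upwards [eventually_gt_atTop 0] with x hx
  have : c + x ^ 2 = x ^ 2 * (c * (x ^ 2)⁻¹ + 1) := by field_simp
  rw [this, sqrt_mul (sq_nonneg x), sqrt_sq hx.le, mul_inv, mul_inv_cancel_left₀ hx.ne']

lemma integrable_inv_sqrt_add_sq_pow_three {c : ℝ} (hc : 0 < c) :
    Integrable (fun x : ℝ => (√(c + x ^ 2) ^ 3)⁻¹) := by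
  have h : IntegrableOn (fun x : ℝ => (√(c + x ^ 2) ^ 3)⁻¹) (Ioi 0) :=
    integrableOn_Ioi_deriv_of_nonneg
      (hasDerivAt_div_sqrt_add_sq hc 0).continuousAt.continuousWithinAt
      (fun x _ => hasDerivAt_div_sqrt_add_sq hc x) (fun x _ => by positivity)
      ((tendsto_div_sqrt_add_sq_atTop c).const_mul c⁻¹)
  rw [← integrableOn_univ, ← Iic_union_Ioi (a := (0 : ℝ)), integrableOn_union]
  refine ⟨?_, h⟩
  rw [integrableOn_Iic_iff_integrableOn_Iio]
  refine (IntegrableOn.comp_neg_Iio (c := (0 : ℝ)) (by simpa using h)).congr_fun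
    (fun x _ => ?_) measurableSet_Iio
  simp only [neg_sq]

lemma integral_inv_sqrt_add_sq_pow_three {c : ℝ} (hc : 0 < c) :
    ∫ x : ℝ, (√(c + x ^ 2) ^ 3)⁻¹ = 2 * c⁻¹ := by
  have ht := (tendsto_div_sqrt_add_sq_atTop c).const_mul c⁻¹
  have hb : Tendsto (fun x : ℝ => c⁻¹ * (x * (√(c + x ^ 2))⁻¹)) atBot (𝓝 (-(c⁻¹ * 1))) := by
    refine (ht.neg.comp tendsto_neg_atBot_atTop).congr fun x => ?_
    simp
  rw [integral_of_hasDerivAt_of_tendsto (hasDerivAt_div_sqrt_add_sq hc)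
    (integrable_inv_sqrt_add_sq_pow_three hc) hb ht]
  ring

lemma integrable_inv_sq_add_sq {m : ℝ} (hm : 0 < m) :
    Integrable (fun x : ℝ => (m ^ 2 + x ^ 2)⁻¹) := by
  have := (integrable_inv_one_add_sq.comp_div hm.ne').const_mul (m ^ 2)⁻¹
  refine this.congr (.of_forall fun x => ?_)
  simp only
  field_simp

/-- The Fourier transform of `x ↦ exp (-m |x|)`. -/
lemma fourier_exp_neg_mul_abs {m : ℝ} (hm : 0 < m) (w : ℝ) :
    FourierTransform.fourier (fun x : ℝ => (rexp (-(m * |x|)) : ℂ)) w =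
      ((2 * m * (m ^ 2 + (2 * π * w) ^ 2)⁻¹ : ℝ) : ℂ) := by
  set a : ℂ := -m + (-2 * π * w : ℝ) * Complex.I with ha
  set b : ℂ := m + (-2 * π * w : ℝ) * Complex.I with hb
  have har : a.re < 0 := by simp [ha, hm]
  have hbr : 0 < b.re := by simp [hb, hm]
  have e1 : ∀ x ∈ Ioi (0 : ℝ), Complex.exp (a * x) =
      Complex.exp (↑(-2 * π * x * w) * Complex.I) • (rexp (-(m * |x|)) : ℂ) := by
    intro x hx
    rw [abs_of_pos hx, Complex.ofReal_exp, smul_eq_mul, ← Complex.exp_add, ha]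
    congr 1; push_cast; ring
  have e2 : ∀ x ∈ Iic (0 : ℝ), Complex.exp (b * x) =
      Complex.exp (↑(-2 * π * x * w) * Complex.I) • (rexp (-(m * |x|)) : ℂ) := by
    intro x hx
    rw [abs_of_nonpos hx, Complex.ofReal_exp, smul_eq_mul, ← Complex.exp_add, hb]
    congr 1; push_cast; ring
  rw [Real.fourier_real_eq_integral_exp_smul, ← integral_add_compl measurableSet_Iic
    (f := fun x : ℝ => Complex.exp (↑(-2 * π * x * w) * Complex.I) • (rexp (-(m * |x|)) : ℂ))
    (s := Iic 0), compl_Iic, ← setIntegral_congr_fun measurableSet_Iic e2,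
    ← setIntegral_congr_fun measurableSet_Ioi e1, integral_exp_mul_complex_Ioi har,
    integral_exp_mul_complex_Iic hbr]
  · have ha0 : a ≠ 0 := fun h => by simp [h] at har
    have hb0 : b ≠ 0 := fun h => by simp [h] at hbr
    have hab : a * b = -((m ^ 2 + (2 * π * w) ^ 2 : ℝ) : ℂ) := by
      rw [ha, hb]; push_cast
      linear_combination (4 * (π : ℂ) ^ 2 * w ^ 2) * Complex.I_sq
    have hne : ((m ^ 2 + (2 * π * w) ^ 2 : ℝ) : ℂ) ≠ 0 := by
      exact_mod_cast (by positivity : (0 : ℝ) < m ^ 2 + (2 * π * w) ^ 2).ne'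
    have : a - b = -(2 * m) := by rw [ha, hb]; ring
    simp only [Complex.ofReal_zero, mul_zero, Complex.exp_zero]
    rw [Complex.ofReal_mul, Complex.ofReal_inv]
    have h2 : 1 / b + -1 / a = (a - b) / (a * b) := by field_simp; ring
    rw [h2, hab, this]
    push_cast
    rw [neg_div_neg_eq, div_eq_mul_inv]
  · rw [← integrableOn_univ, ← Iic_union_Ioi (a := (0 : ℝ)), integrableOn_union]
    exact ⟨(integrableOn_exp_mul_complex_Iic hbr 0).congr_fun e2 measurableSet_Iic,
      (integrableOn_exp_mul_complex_Ioi har 0).congr_fun e1 measurableSet_Ioi⟩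

lemma integrable_exp_neg_mul_abs {m : ℝ} (hm : 0 < m) :
    Integrable (fun x : ℝ => rexp (-(m * |x|))) := by
  rw [← integrableOn_univ, ← Iic_union_Ioi (a := (0 : ℝ)), integrableOn_union]
  refine ⟨(integrableOn_exp_mul_Iic hm 0).congr_fun (fun x (hx : x ≤ 0) => ?_) measurableSet_Iic,
      (integrableOn_exp_mul_Ioi (neg_lt_zero.2 hm) 0).congr_fun (fun x (hx : 0 < x) => ?_) measurableSet_Ioi⟩
  · simp only [abs_of_nonpos hx, mul_neg, neg_neg]
  · simp only [abs_of_pos hx, neg_mul]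

/-- The Fourier transform of the Cauchy density. -/
lemma integral_cos_mul_inv_sq_add_sq {m : ℝ} (hm : 0 < m) (y : ℝ) :
    ∫ x : ℝ, cos (x * y) * (m ^ 2 + x ^ 2)⁻¹ = π / m * rexp (-(m * |y|)) := by
  have hi : Integrable (fun x : ℝ => (rexp (-(m * |x|)) : ℂ)) :=
    (integrable_exp_neg_mul_abs hm).ofReal
  have hF : FourierTransform.fourier (fun x : ℝ => (rexp (-(m * |x|)) : ℂ)) =
      fun w : ℝ => ((2 * m * (m ^ 2 + (2 * π * w) ^ 2)⁻¹ : ℝ) : ℂ) :=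
    funext (fourier_exp_neg_mul_abs hm)
  have h2π : 2 * π ≠ 0 := by positivity
  have hFi : Integrable (fun w : ℝ => ((2 * m * (m ^ 2 + (2 * π * w) ^ 2)⁻¹ : ℝ) : ℂ)) :=
    (((integrable_inv_sq_add_sq hm).comp_mul_left' h2π).const_mul (2 * m)).ofReal
  have hinv := congrFun (Continuous.fourierInv_fourier_eq
    (f := fun x : ℝ => (rexp (-(m * |x|)) : ℂ)) (by fun_prop) hi (hF ▸ hFi)) y
  rw [hF, Real.fourierInv_eq'] at hinv
  have hre := congrArg Complex.re hinv
  rw [Complex.ofReal_re, ← RCLike.re_eq_complex_re, ← integral_re] at hre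
  · have hsub := Measure.integral_comp_mul_left
      (fun x : ℝ => cos (x * y) * (m ^ 2 + x ^ 2)⁻¹) (2 * π)
    have hre' : ∫ w : ℝ, 2 * m * (cos (2 * π * w * y) * (m ^ 2 + (2 * π * w) ^ 2)⁻¹) =
        rexp (-(m * |y|)) := by
      rw [← hre]
      congr 1 with w
      rw [smul_eq_mul, RCLike.re_eq_complex_re, mul_comm (Complex.exp _), Complex.re_ofReal_mul,
        Complex.exp_ofReal_mul_I_re]
      rw [show inner ℝ w y = y * w from rfl]
      ring_nf
    rw [MeasureTheory.integral_const_mul, hsub, abs_of_pos (by positivity), smul_eq_mul] at hre'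
    rw [← hre']
    generalize ∫ x : ℝ, cos (x * y) * (m ^ 2 + x ^ 2)⁻¹ = I
    field_simp
  · refine hFi.bdd_mul (c := 1) (by fun_prop) (.of_forall fun w => ?_)
    rw [Complex.norm_exp_ofReal_mul_I]

/-- The Bessel function of the first kind of order 1. -/
noncomputable def besselJ1 (x : ℝ) : ℝ :=
  (1 / π) * ∫ θ in (0 : ℝ)..π, sin θ * sin (x * sin θ)

lemma hasDerivAt_besselJ0 (x : ℝ) : HasDerivAt besselJ0 (-besselJ1 x) x := by
  have h := (intervalIntegral.hasDerivAt_integral_of_dominated_loc_of_deriv_le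
    (μ := volume) (a := 0) (b := π) (bound := fun _ => 1) (x₀ := x) (s := univ)
    (F := fun x θ => cos (x * sin θ)) (F' := fun x θ => -(sin θ * sin (x * sin θ)))
    univ_mem (.of_forall fun x => Continuous.aestronglyMeasurable (by fun_prop))
    (Continuous.intervalIntegrable (by fun_prop) _ _)
    (Continuous.aestronglyMeasurable (by fun_prop))
    (.of_forall fun θ _ x _ => ?_) (by simp) (.of_forall fun θ _ x _ => ?_)).2
  · refine (h.const_mul (1 / π)).congr_deriv ?_
    rw [intervalIntegral.integral_neg, besselJ1, mul_neg]
  · rw [norm_neg, norm_mul]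
    exact mul_le_one₀ (abs_sin_le_one _) (norm_nonneg _) (abs_sin_le_one _)
  · exact (((hasDerivAt_id x).mul_const (sin θ)).cos).congr_deriv (by simp; ring)

lemma hasDerivAt_besselJ1 (x : ℝ) :
    HasDerivAt besselJ1 ((1 / π) * ∫ θ in (0 : ℝ)..π, sin θ ^ 2 * cos (x * sin θ)) x := by
  have h := (intervalIntegral.hasDerivAt_integral_of_dominated_loc_of_deriv_le
    (μ := volume) (a := 0) (b := π) (bound := fun _ => 1) (x₀ := x) (s := univ)
    (F := fun x θ => sin θ * sin (x * sin θ)) (F' := fun x θ => sin θ ^ 2 * cos (x * sin θ))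
    univ_mem (.of_forall fun x => Continuous.aestronglyMeasurable (by fun_prop))
    (Continuous.intervalIntegrable (by fun_prop) _ _)
    (Continuous.aestronglyMeasurable (by fun_prop))
    (.of_forall fun θ _ x _ => ?_) (by simp) (.of_forall fun θ _ x _ => ?_)).2
  · exact h.const_mul (1 / π)
  · rw [norm_mul, norm_pow]
    exact mul_le_one₀ (pow_le_one₀ (norm_nonneg _) (abs_sin_le_one _)) (norm_nonneg _)
      (abs_cos_le_one _)
  · exact ((((hasDerivAt_id x).mul_const (sin θ)).sin).const_mul (sin θ)).congr_deriv
      (by simp; ring)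

lemma continuous_besselJ0 : Continuous besselJ0 :=
  continuous_iff_continuousAt.2 fun x => (hasDerivAt_besselJ0 x).continuousAt

lemma continuous_besselJ1 : Continuous besselJ1 :=
  continuous_iff_continuousAt.2 fun x => (hasDerivAt_besselJ1 x).continuousAt

/-- The derivative of `x J₁(x)` is `x J₀(x)`. -/
lemma hasDerivAt_mul_besselJ1 (x : ℝ) :
    HasDerivAt (fun x => x * besselJ1 x) (x * besselJ0 x) x := by
  refine ((hasDerivAt_id x).mul (hasDerivAt_besselJ1 x)).congr_deriv ?_
  have hd : ∀ θ ∈ uIcc 0 π, HasDerivAt (fun θ => cos θ * sin (x * sin θ))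
      (x * cos (x * sin θ) - x * (sin θ ^ 2 * cos (x * sin θ)) - sin θ * sin (x * sin θ)) θ := by
    intro θ _
    refine ((hasDerivAt_cos θ).mul (((hasDerivAt_sin θ).const_mul x).sin)).congr_deriv ?_
    linear_combination x * cos (x * sin θ) * cos_sq' θ
  have h := integral_eq_sub_of_hasDerivAt hd (Continuous.intervalIntegrable (by fun_prop) _ _)
  rw [intervalIntegral.integral_sub, intervalIntegral.integral_sub,
    intervalIntegral.integral_const_mul, intervalIntegral.integral_const_mul] at h
  · simp only [sin_pi, sin_zero, mul_zero, sub_zero] at h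
    simp only [id, besselJ0, besselJ1]
    linear_combination (-(1 / π)) * h
  all_goals exact Continuous.intervalIntegrable (by fun_prop) _ _

lemma abs_besselJ0_le_one (x : ℝ) : |besselJ0 x| ≤ 1 := by
  have h := intervalIntegral.norm_integral_le_of_norm_le_const (a := 0) (b := π) (C := 1)
    (f := fun θ => cos (x * sin θ)) (fun θ _ => abs_cos_le_one _)
  rw [sub_zero, one_mul, abs_of_pos pi_pos, Real.norm_eq_abs] at h
  rw [besselJ0, abs_mul, abs_of_pos (by positivity), one_div_mul_eq_div]
  exact div_le_one_of_le₀ h pi_pos.le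

lemma integral_cos_mul_sin_neg_pi_pi (x : ℝ) :
    ∫ θ in (-π)..π, cos (x * sin θ) = 2 * π * besselJ0 x := by
  have hper : Function.Periodic (fun θ => cos (x * sin θ)) π := fun θ => by simp [sin_add_pi]
  have h := hper.intervalIntegral_add_eq (-π) 0
  rw [neg_add_cancel, zero_add] at h
  rw [← intervalIntegral.integral_add_adjacent_intervals (b := 0), h, besselJ0]
  · field_simp
    ring
  all_goals exact Continuous.intervalIntegrable (by fun_prop) _ _

lemma image_sin_Ioo : sin '' Ioo (-(π / 2)) (π / 2) = Ioo (-1) 1 := by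
  ext u
  constructor
  · rintro ⟨θ, hθ, rfl⟩
    have h1 := strictMonoOn_sin ⟨le_rfl, by linarith [pi_pos]⟩ (Ioo_subset_Icc_self hθ) hθ.1
    have h2 := strictMonoOn_sin (Ioo_subset_Icc_self hθ) ⟨by linarith [pi_pos], le_rfl⟩ hθ.2
    rw [sin_neg, sin_pi_div_two] at h1
    rw [sin_pi_div_two] at h2
    exact ⟨h1, h2⟩
  · intro hu
    exact ⟨arcsin u, ⟨neg_pi_div_two_lt_arcsin.2 hu.1, arcsin_lt_pi_div_two.2 hu.2⟩,
      sin_arcsin hu.1.le hu.2.le⟩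

lemma tendsto_besselJ1_atTop : Tendsto besselJ1 atTop (𝓝 0) := by
  let G : ℝ → ℂ := fun u => ((u / √(1 - u ^ 2) : ℝ) : ℂ)
  have hRL := (Real.tendsto_integral_exp_smul_cocompact ((Ioo (-1 : ℝ) 1).indicator G)).mono_left
    atTop_le_cocompact
  have hx : Tendsto (fun x : ℝ => x / (2 * π)) atTop atTop :=
    tendsto_id.atTop_div_const (by positivity)
  have h := ((Complex.continuous_im.tendsto _).comp (hRL.comp hx)).const_mul (-(1 / π))
  rw [Complex.zero_im, mul_zero] at h
  refine h.congr fun x => ?_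
  have key : ∫ v : ℝ, Real.fourierChar (-(v * (x / (2 * π)))) • (Ioo (-1 : ℝ) 1).indicator G v =
      ∫ θ in Ioo (-(π / 2)) (π / 2), (sin θ : ℂ) * Complex.exp ((-(x * sin θ) : ℝ) * Complex.I) := by
    have e : (fun v : ℝ => Real.fourierChar (-(v * (x / (2 * π)))) • (Ioo (-1 : ℝ) 1).indicator G v)
        = (Ioo (-1 : ℝ) 1).indicator
          (fun v : ℝ => Real.fourierChar (-(v * (x / (2 * π)))) • G v) := by
      ext v
      by_cases hv : v ∈ Ioo (-1 : ℝ) 1 <;> simp [hv]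
    rw [e, MeasureTheory.integral_indicator measurableSet_Ioo, ← image_sin_Ioo,
      integral_image_eq_integral_abs_deriv_smul measurableSet_Ioo
        (fun θ _ => (hasDerivAt_sin θ).hasDerivWithinAt)
        (injOn_sin.mono Ioo_subset_Icc_self)]
    refine setIntegral_congr_fun measurableSet_Ioo fun θ hθ => ?_
    have hc : 0 < cos θ := cos_pos_of_mem_Ioo hθ
    have hs : √(1 - sin θ ^ 2) = cos θ := by rw [← cos_sq', sqrt_sq hc.le]
    have hcC : (cos θ : ℂ) ≠ 0 := by exact_mod_cast hc.ne'
    have harg : 2 * π * -(sin θ * (x / (2 * π))) = -(x * sin θ) := by field_simp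
    simp only [G, hs, abs_of_pos hc, Circle.smul_def, Real.fourierChar_apply, harg,
      Complex.real_smul, smul_eq_mul]
    rw [Complex.ofReal_div]
    field_simp
  have hper : Function.Periodic (fun θ => sin θ * sin (x * sin θ)) π :=
    fun θ => by simp [sin_add_pi]
  have hp := hper.intervalIntegral_add_eq (-(π / 2)) 0
  rw [zero_add, show -(π / 2) + π = π / 2 by ring,
    intervalIntegral.integral_of_le (by linarith [pi_pos]), integral_Ioc_eq_integral_Ioo] at hp
  simp only [Function.comp]
  rw [key, besselJ1, ← hp, ← RCLike.im_eq_complex_im, ← integral_im, neg_mul, ← mul_neg,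
    ← MeasureTheory.integral_neg]
  · congr 2 with θ
    rw [RCLike.im_eq_complex_im, Complex.im_ofReal_mul, Complex.exp_ofReal_mul_I_im, sin_neg]
    ring
  · exact (Continuous.integrableOn_Icc (by fun_prop)).mono_set Ioo_subset_Icc_self

lemma integrable_inv_sqrt_add_sq_add_sq_pow_three {m : ℝ} (hm : 0 < m) :
    Integrable (fun z : ℝ × ℝ => (√(m ^ 2 + z.2 ^ 2 + z.1 ^ 2) ^ 3)⁻¹)
      ((volume : Measure ℝ).prod volume) := by
  have hc : ∀ x : ℝ, 0 < m ^ 2 + x ^ 2 := fun x => by positivity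
  have hcont : Continuous (fun z : ℝ × ℝ => (√(m ^ 2 + z.2 ^ 2 + z.1 ^ 2) ^ 3)⁻¹) :=
    Continuous.inv₀ (by fun_prop) fun z => by positivity
  refine (integrable_prod_iff' hcont.aestronglyMeasurable).2
    ⟨.of_forall fun x => integrable_inv_sqrt_add_sq_pow_three (hc x), ?_⟩
  refine ((integrable_inv_sq_add_sq hm).const_mul 2).congr (.of_forall fun x => ?_)
  simp only
  rw [← integral_inv_sqrt_add_sq_pow_three (hc x)]
  congr 1 with u
  rw [Real.norm_of_nonneg (by positivity)]

lemma integrableOn_mul_inv_sqrt_add_sq_pow_three {c : ℝ} (hc : 0 < c) :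
    IntegrableOn (fun p : ℝ => p * (√(c + p ^ 2) ^ 3)⁻¹) (Ioi 0) := by
  refine integrableOn_Ioi_deriv_of_nonneg (g := fun p => -(√(c + p ^ 2))⁻¹) (l := -0)
    (hasDerivAt_inv_sqrt_add_sq hc 0).neg.continuousAt.continuousWithinAt
    (fun x _ => (hasDerivAt_inv_sqrt_add_sq hc x).neg.congr_deriv (neg_neg _))
    (fun x hx => mul_nonneg (le_of_lt hx) (by positivity))
    (tendsto_inv_atTop_zero.comp (tendsto_sqrt_add_sq_atTop c)).neg

lemma integrableOn_besselJ0_mul {m : ℝ} (hm : 0 < m) (y : ℝ) :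
    IntegrableOn (fun p : ℝ => p * (√(m ^ 2 + p ^ 2) ^ 3)⁻¹ * besselJ0 (p * y)) (Ioi 0) :=
  (integrableOn_mul_inv_sqrt_add_sq_pow_three (by positivity)).mul_bdd (c := 1)
    (continuous_besselJ0.comp (by fun_prop)).aestronglyMeasurable
    (.of_forall fun _ => abs_besselJ0_le_one _)

/-- The Hankel transform of `p ↦ (m² + p²)^(-3/2)`, obtained by writing the two-dimensional Fourier
transform of this radial function in polar and in Cartesian coordinates. -/
lemma integral_besselJ0_mul {m y : ℝ} (hm : 0 < m) (hy : 0 ≤ y) :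
    ∫ p in Ioi (0 : ℝ), p * (√(m ^ 2 + p ^ 2) ^ 3)⁻¹ * besselJ0 (p * y) =
      rexp (-(m * y)) / m := by
  let f : ℝ × ℝ → ℝ := fun z => cos (z.2 * y) * (√(m ^ 2 + z.2 ^ 2 + z.1 ^ 2) ^ 3)⁻¹
  have hf : Integrable f ((volume : Measure ℝ).prod volume) :=
    (integrable_inv_sqrt_add_sq_add_sq_pow_three hm).bdd_mul (c := 1)
      (Continuous.aestronglyMeasurable (by fun_prop)) (.of_forall fun z => abs_cos_le_one _)
  have hcart : ∫ z, f z = 2 * π / m * rexp (-(m * y)) := by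
    rw [Measure.volume_eq_prod, integral_prod_symm _ hf]
    have : ∀ q : ℝ, ∫ p : ℝ, f (p, q) = 2 * (cos (q * y) * (m ^ 2 + q ^ 2)⁻¹) := fun q => by
      simp only [f]
      rw [MeasureTheory.integral_const_mul, integral_inv_sqrt_add_sq_pow_three (by positivity)]
      ring
    simp only [this]
    rw [MeasureTheory.integral_const_mul, integral_cos_mul_inv_sq_add_sq hm, abs_of_nonneg hy]
    ring
  have hpolar : ∫ z, f z =
      2 * π * ∫ p in Ioi (0 : ℝ), p * (√(m ^ 2 + p ^ 2) ^ 3)⁻¹ * besselJ0 (p * y) := by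
    have hval : ∀ r θ : ℝ, r • f (r * cos θ, r * sin θ) =
        r * (√(m ^ 2 + r ^ 2) ^ 3)⁻¹ * cos (r * y * sin θ) := fun r θ => by
      have : m ^ 2 + (r * sin θ) ^ 2 + (r * cos θ) ^ 2 = m ^ 2 + r ^ 2 := by
        linear_combination r ^ 2 * sin_sq_add_cos_sq θ
      simp only [f, smul_eq_mul, this]
      rw [show r * sin θ * y = r * y * sin θ by ring]
      ring
    rw [← integral_comp_polarCoord_symm, polarCoord_target, Measure.volume_eq_prod]
    simp only [polarCoord_symm_apply, hval]
    rw [setIntegral_prod, ← MeasureTheory.integral_const_mul]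
    · congr 1 with r
      simp only
      rw [MeasureTheory.integral_const_mul, ← integral_Ioc_eq_integral_Ioo,
        ← intervalIntegral.integral_of_le (by linarith [pi_pos]), integral_cos_mul_sin_neg_pi_pi]
      ring
    · have h1 : Integrable (fun _ : ℝ => (1 : ℝ)) (volume.restrict (Ioo (-π) π)) :=
        integrableOn_const (by simp)
      have h2 := Integrable.mul_prod
        (integrableOn_mul_inv_sqrt_add_sq_pow_three (c := m ^ 2) (by positivity)) h1
      rw [IntegrableOn, ← Measure.prod_restrict]
      simp only [mul_one] at h2
      exact h2.mul_bdd (c := 1) (Continuous.aestronglyMeasurable (by fun_prop))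
        (.of_forall fun z => abs_cos_le_one _)
  rw [hcart] at hpolar
  field_simp at hpolar ⊢
  linarith

lemma abs_mul_log_div_le {m p : ℝ} (hm : 0 ≤ m) (hp : 0 < p) :
    |p * (log p - log (m + √(m ^ 2 + p ^ 2)))| ≤ 2 * m := by
  have h1 : p ≤ √(m ^ 2 + p ^ 2) := le_sqrt_of_sq_le (by nlinarith)
  have h2 : √(m ^ 2 + p ^ 2) ≤ m + p := sqrt_le_iff.2 ⟨by positivity, by nlinarith⟩
  have h3 : log p ≤ log (m + √(m ^ 2 + p ^ 2)) := log_le_log hp (by linarith)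
  rw [abs_of_nonpos (mul_nonpos_of_nonneg_of_nonpos hp.le (by linarith))]
  have h4 := log_le_sub_one_of_pos (x := (m + √(m ^ 2 + p ^ 2)) / p) (by positivity)
  rw [log_div (by positivity) hp.ne'] at h4
  have h5 := mul_le_mul_of_nonneg_left h4 hp.le
  rw [mul_sub p (_ / _), mul_div_cancel₀ _ hp.ne'] at h5
  linarith

/-- Antiderivative produced by two integrations by parts. -/
lemma hasDerivAt_besselJ1_mul_log_add {m y p : ℝ} (hm : 0 < m) (hy : 0 < y) (hp : 0 < p) :
    HasDerivAt (fun p => besselJ1 (p * y) / y * (p * log p - p * log (m + √(m ^ 2 + p ^ 2))) +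
        m / y ^ 2 * (besselJ0 (p * y) * (√(m ^ 2 + p ^ 2))⁻¹))
      (besselJ0 (p * y) * (p * log p - p * log (m + √(m ^ 2 + p ^ 2))) -
        m / y ^ 2 * (p * (√(m ^ 2 + p ^ 2) ^ 3)⁻¹ * besselJ0 (p * y))) p := by
  have hm2 : 0 < m ^ 2 := by positivity
  have hg : 0 < √(m ^ 2 + p ^ 2) := by positivity
  have hg2 : √(m ^ 2 + p ^ 2) ^ 2 = m ^ 2 + p ^ 2 := sq_sqrt (by positivity)
  have hlin : HasDerivAt (fun p : ℝ => p * y) y p := by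
    simpa using (hasDerivAt_id p).mul_const y
  have hJ1 := ((hasDerivAt_mul_besselJ1 (p * y)).comp p hlin).div_const (y ^ 2)
  have hJ0 := (hasDerivAt_besselJ0 (p * y)).comp p hlin
  have hlog := (hasDerivAt_log hp.ne').sub
    (((hasDerivAt_sqrt_add_sq hm2 p).const_add m).log (by positivity))
  have h := (hJ1.mul hlog).add
    ((hJ0.mul (hasDerivAt_inv_sqrt_add_sq hm2 p)).const_mul (m / y ^ 2))
  have hlog' : p⁻¹ - p / √(m ^ 2 + p ^ 2) / (m + √(m ^ 2 + p ^ 2)) =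
      m / (p * √(m ^ 2 + p ^ 2)) := by
    field_simp
    linear_combination hg2
  rw [hlog'] at h
  refine (h.congr_deriv ?_).congr_of_eventuallyEq (.of_forall fun q => ?_)
  · simp only [Function.comp, Pi.sub_apply]
    field_simp
    ring
  · simp only [Function.comp, Pi.add_apply, Pi.mul_apply, Pi.sub_apply]
    field_simp

end

/-- For `m ≥ 0` and `y > 0`, the improper oscillatory integral
`∫₀^∞ p J₀(py) ln( p/(m + √(m² + p²)) ) dp` converges and equals `(e^{−my} − 1)/y²`. -/
theorem hankel_log_integral (m y : ℝ) (hm : 0 ≤ m) (hy : 0 < y) :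
    Tendsto
      (fun R : ℝ => ∫ p in (0:ℝ)..R,
        p * besselJ0 (p * y) * Real.log (p / (m + Real.sqrt (m ^ 2 + p ^ 2))))
      atTop (nhds ((Real.exp (-(m * y)) - 1) / y ^ 2)) := by
  rcases hm.eq_or_lt with rfl | hm
  · have h0 : ∀ R : ℝ, 0 ≤ R → ∫ p in (0:ℝ)..R,
        p * besselJ0 (p * y) * Real.log (p / (0 + √(0 ^ 2 + p ^ 2))) = 0 := fun R hR => by
      refine (integral_congr fun p hp => ?_).trans integral_zero
      rw [Set.uIcc_of_le hR] at hp
      rcases hp.1.eq_or_lt with rfl | hp0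
      · simp
      · simp [sqrt_sq hp0.le, hp0.ne']
    refine tendsto_const_nhds.congr' ?_
    filter_upwards [eventually_ge_atTop 0] with R hR
    rw [h0 R hR]
    simp
  have hint : ∀ p : ℝ, p * besselJ0 (p * y) * Real.log (p / (m + √(m ^ 2 + p ^ 2))) =
      besselJ0 (p * y) * (p * log p - p * log (m + √(m ^ 2 + p ^ 2))) := fun p => by
    rcases eq_or_ne p 0 with rfl | hp
    · simp
    · rw [log_div hp (by positivity)]
      ring
  simp only [hint]
  have hJ0 : Continuous fun p => besselJ0 (p * y) := continuous_besselJ0.comp (by fun_prop)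
  have hJ1 : Continuous fun p => besselJ1 (p * y) := continuous_besselJ1.comp (by fun_prop)
  have hg : Continuous fun p : ℝ => (√(m ^ 2 + p ^ 2))⁻¹ :=
    Continuous.inv₀ (by fun_prop) fun p => by positivity
  have hg3 : Continuous fun p : ℝ => (√(m ^ 2 + p ^ 2) ^ 3)⁻¹ :=
    Continuous.inv₀ (by fun_prop) fun p => by positivity
  have hlog : Continuous fun p : ℝ => p * log p - p * log (m + √(m ^ 2 + p ^ 2)) :=
    continuous_mul_log.sub (continuous_id.mul
      (Continuous.log (by fun_prop) fun p => by positivity))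
  let Φ : ℝ → ℝ := fun p =>
    besselJ1 (p * y) / y * (p * log p - p * log (m + √(m ^ 2 + p ^ 2))) +
      m / y ^ 2 * (besselJ0 (p * y) * (√(m ^ 2 + p ^ 2))⁻¹)
  have hΦ : Continuous Φ :=
    ((hJ1.div_const y).mul hlog).add (continuous_const.mul (hJ0.mul hg))
  have hΦ0 : Φ 0 = 1 / y ^ 2 := by
    have : besselJ0 0 = 1 := by simp [besselJ0, pi_ne_zero]
    simp only [Φ, this, zero_mul, sub_zero, mul_zero, zero_add, one_mul]
    rw [zero_pow two_ne_zero, add_zero, sqrt_sq hm.le]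
    field_simp
  have hpy : Tendsto (fun p : ℝ => p * y) atTop atTop := tendsto_id.atTop_mul_const hy
  have hΦlim : Tendsto Φ atTop (nhds (0 + m / y ^ 2 * 0)) := by
    refine Tendsto.add ?_ (Tendsto.const_mul _ ?_)
    · refine Tendsto.zero_mul_isBoundedUnder_le ?_ ⟨2 * m, ?_⟩
      · simpa using (tendsto_besselJ1_atTop.comp hpy).div_const y
      · rw [eventually_map]
        filter_upwards [eventually_gt_atTop 0] with p hp
        simpa [mul_sub] using abs_mul_log_div_le hm.le hp
    · refine isBoundedUnder_le_mul_tendsto_zero ⟨1, ?_⟩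
        (tendsto_inv_atTop_zero.comp (tendsto_sqrt_add_sq_atTop (m ^ 2)))
      rw [eventually_map]
      exact .of_forall fun p => abs_besselJ0_le_one _
  have hK : Tendsto (fun R : ℝ => ∫ p in (0 : ℝ)..R,
      p * (√(m ^ 2 + p ^ 2) ^ 3)⁻¹ * besselJ0 (p * y)) atTop (nhds (rexp (-(m * y)) / m)) := by
    rw [← integral_besselJ0_mul hm hy.le]
    exact intervalIntegral_tendsto_integral_Ioi 0 (integrableOn_besselJ0_mul hm y) tendsto_id
  have hfin := (hΦlim.sub_const (Φ 0)).add (hK.const_mul (m / y ^ 2))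
  rw [hΦ0] at hfin
  have hval : 0 + m / y ^ 2 * 0 - 1 / y ^ 2 + m / y ^ 2 * (rexp (-(m * y)) / m) =
      (rexp (-(m * y)) - 1) / y ^ 2 := by
    field_simp
    ring
  rw [hval] at hfin
  refine hfin.congr' ?_
  filter_upwards [eventually_ge_atTop 0] with R hR
  have hi1 : IntervalIntegrable (fun p : ℝ =>
      besselJ0 (p * y) * (p * log p - p * log (m + √(m ^ 2 + p ^ 2)))) volume 0 R :=
    (hJ0.mul hlog).intervalIntegrable _ _
  have hi2 : IntervalIntegrable (fun p : ℝ =>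
      m / y ^ 2 * (p * (√(m ^ 2 + p ^ 2) ^ 3)⁻¹ * besselJ0 (p * y))) volume 0 R :=
    (continuous_const.mul ((continuous_id.mul hg3).mul hJ0)).intervalIntegrable _ _
  have hftc := integral_eq_sub_of_hasDerivAt_of_le hR hΦ.continuousOn
    (fun p hp => hasDerivAt_besselJ1_mul_log_add hm hy hp.1) (hi1.sub hi2)
  rw [intervalIntegral.integral_sub hi1 hi2, intervalIntegral.integral_const_mul, hΦ0] at hftc
  linarith
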